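/- arXiv:1911.07548 — 9 statements merged into one kernel-verified Lean document; each statement's English description precedes it below -/
import Mathlib

section
/- Suppose every diagonal entry μ_i of Ῡ satisfies 0 < μ_i < 1, every diagonal entry of Ω_g is strictly positive, and F x ≠ 0. Then G_F and G_G are invertible and x^T F^T Ῡ G_F^{-1} F x > x^T F^T Ῡ G_G^{-1} F x; consequently, for every constant c ∈ ℝ, the UDP-like optimal cost c − x^T F^T Ῡ G_G^{-1} F x is strictly greater than the TCP-like optimal cost c − x^T F^T Ῡ G_F^{-1} F x. -/
open Matrix

theorem aux_quad {p : ℕ} (A D : Matrix (Fin p) (Fin p) ℝ) (hA : A.PosDef) (hD : D.PosDef)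
    (v : Fin p → ℝ) (hv : v ≠ 0) : v ⬝ᵥ ((A + D)⁻¹ *ᵥ v) < v ⬝ᵥ (A⁻¹ *ᵥ v) := by
  have hB : (A + D).PosDef := hA.add hD
  have uA : IsUnit A.det := hA.det_pos.ne'.isUnit
  have uB : IsUnit (A + D).det := hB.det_pos.ne'.isUnit
  obtain ⟨y, hy⟩ : ∃ y, y = A⁻¹ *ᵥ v := ⟨_, rfl⟩
  obtain ⟨z, hz⟩ : ∃ z, z = (A + D)⁻¹ *ᵥ v := ⟨_, rfl⟩
  have e1 : A *ᵥ y = v := by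
    rw [hy, mulVec_mulVec, mul_nonsing_inv _ uA, one_mulVec]
  have e2 : A *ᵥ z + D *ᵥ z = v := by
    rw [← add_mulVec, hz, mulVec_mulVec, mul_nonsing_inv _ uB, one_mulVec]
  have hz0 : z ≠ 0 := by
    rintro rfl
    apply hv
    rw [← e2]; simp
  rw [← hy, ← hz]
  have h1 : 0 ≤ (y - z) ⬝ᵥ (A *ᵥ (y - z)) := by
    simpa using hA.posSemidef.dotProduct_mulVec_nonneg (y - z)
  have h2 : 0 < z ⬝ᵥ (D *ᵥ z) := by
    simpa using hD.dotProduct_mulVec_pos hz0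
  have hs : Aᵀ = A := by simpa using hA.isHermitian.eq
  have h3 : y ⬝ᵥ (A *ᵥ z) = v ⬝ᵥ z := by
    rw [dotProduct_mulVec, ← mulVec_transpose, hs, e1]
  have h4 : z ⬝ᵥ (A *ᵥ z) + z ⬝ᵥ (D *ᵥ z) = v ⬝ᵥ z := by
    rw [← dotProduct_add, e2, dotProduct_comm]
  rw [mulVec_sub, e1, sub_dotProduct, dotProduct_sub, dotProduct_sub, h3,
    dotProduct_comm y v, dotProduct_comm z v] at h1
  linarith

/-- if every packet-transmission probability satisfies `0 < μ i < 1`, every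
diagonal entry of `Ωg` is strictly positive, and `F x ≠ 0`, then `G_F = Ωg Ῡ + Ψ` and
`G_G = Ωg Ῡ + Ψ + Ωd (I − Ῡ)` are invertible, the TCP-like quadratic exceeds the UDP-like one,
and hence the UDP-like optimal cost `c − xᵀFᵀῩ G_G⁻¹ F x` strictly exceeds the TCP-like optimal
cost `c − xᵀFᵀῩ G_F⁻¹ F x` for every constant `c`. -/
theorem udp_cost_gt_tcp_cost
    (p n : ℕ) (hp : 0 < p) (hn : 0 < n)
    (Ωg : Matrix (Fin p) (Fin p) ℝ) (hΩg : Ωg.PosSemidef)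
    (hΩgd : ∀ i, 0 < Ωg i i)
    (ψ : Fin p → ℝ) (hψ : ∀ i, 0 < ψ i)
    (μ : Fin p → ℝ) (hμ : ∀ i, 0 < μ i ∧ μ i < 1)
    (F : Matrix (Fin p) (Fin n) ℝ) (x : Fin n → ℝ)
    (hFx : F *ᵥ x ≠ 0) :
    let Ψ : Matrix (Fin p) (Fin p) ℝ := Matrix.diagonal ψ
    let Ωd : Matrix (Fin p) (Fin p) ℝ := Matrix.diagonal (fun i => Ωg i i)
    let Υ : Matrix (Fin p) (Fin p) ℝ := Matrix.diagonal μ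
    let GF : Matrix (Fin p) (Fin p) ℝ := Ωg * Υ + Ψ
    let GG : Matrix (Fin p) (Fin p) ℝ := Ωg * Υ + Ψ + Ωd * (1 - Υ)
    IsUnit GF.det ∧ IsUnit GG.det ∧
      (F *ᵥ x) ⬝ᵥ ((Υ * GF⁻¹) *ᵥ (F *ᵥ x)) > (F *ᵥ x) ⬝ᵥ ((Υ * GG⁻¹) *ᵥ (F *ᵥ x)) ∧
      ∀ c : ℝ,
        c - (F *ᵥ x) ⬝ᵥ ((Υ * GG⁻¹) *ᵥ (F *ᵥ x)) >
          c - (F *ᵥ x) ⬝ᵥ ((Υ * GF⁻¹) *ᵥ (F *ᵥ x)) := by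
  intro Ψ Ωd Υ GF GG
  have hm : ∀ i, μ i ≠ 0 := fun i => (hμ i).1.ne'
  let A : Matrix (Fin p) (Fin p) ℝ := Ωg + Matrix.diagonal (fun i => ψ i / μ i)
  let D : Matrix (Fin p) (Fin p) ℝ := Matrix.diagonal (fun i => Ωg i i * (1 - μ i) / μ i)
  have hA : A.PosDef := PosDef.posSemidef_add hΩg
    (PosDef.diagonal fun i => div_pos (hψ i) (hμ i).1)
  have hD : D.PosDef := PosDef.diagonal fun i =>
    div_pos (mul_pos (hΩgd i) (sub_pos.2 (hμ i).2)) (hμ i).1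
  have eF : GF = A * Υ := by
    simp only [GF, A, Υ, Ψ, add_mul, diagonal_mul_diagonal]
    congr 2; funext i; rw [div_mul_cancel₀ _ (hm i)]
  have eG : GG = (A + D) * Υ := by
    rw [add_mul, ← eF]
    simp only [GG, GF, D, Υ, Ωd, diagonal_mul_diagonal, mul_sub, mul_one, diagonal_sub]
    congr 2; funext i; rw [div_mul_cancel₀ _ (hm i)]
  have uU : IsUnit Υ.det := by
    rw [isUnit_iff_ne_zero]
    simp only [Υ, det_diagonal]
    exact Finset.prod_ne_zero_iff.2 fun i _ => hm i
  have key : (F *ᵥ x) ⬝ᵥ ((Υ * GG⁻¹) *ᵥ (F *ᵥ x)) < (F *ᵥ x) ⬝ᵥ ((Υ * GF⁻¹) *ᵥ (F *ᵥ x)) := by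
    rw [eF, eG, Matrix.mul_inv_rev, Matrix.mul_inv_rev, mul_nonsing_inv_cancel_left _ _ uU,
      mul_nonsing_inv_cancel_left _ _ uU]
    exact aux_quad A D hA hD _ hFx
  refine ⟨?_, ?_, key, fun c => sub_lt_sub_left key c⟩
  · rw [eF, det_mul]; exact hA.det_pos.ne'.isUnit.mul uU
  · rw [eG, det_mul]; exact (hA.add hD).det_pos.ne'.isUnit.mul uU
end

section
/- Let Ῡ₁ and Ῡ₂ be p×p diagonal matrices with diagonal entries μ_{1,i} and μ_{2,i} satisfying 0 < μ_{1,i} < μ_{2,i} for every i, and suppose F x ≠ 0. Then Ῡ₁ Ω_g + Ψ and Ῡ₂ Ω_g + Ψ are invertible and x^T F^T (Ῡ₂ Ω_g + Ψ)^{-1} Ῡ₂ F x > x^T F^T (Ῡ₁ Ω_g + Ψ)^{-1} Ῡ₁ F x; that is, for any constant c the TCP-like optimal cost c − x^T F^T (Ῡ Ω_g + Ψ)^{-1} Ῡ F x is strictly decreasing in the packet-transmission probabilities. -/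
open Matrix

theorem aux_inv {p : ℕ} (A B : Matrix (Fin p) (Fin p) ℝ) (hA : A.PosDef) (hB : B.PosDef)
    (hAB : (A - B).PosDef) (y : Fin p → ℝ) (hy : y ≠ 0) :
    y ⬝ᵥ (A⁻¹ *ᵥ y) < y ⬝ᵥ (B⁻¹ *ᵥ y) := by
  have uA : IsUnit A.det := hA.det_pos.ne'.isUnit
  have uB : IsUnit B.det := hB.det_pos.ne'.isUnit
  set u := A⁻¹ *ᵥ y with hu
  set v := B⁻¹ *ᵥ y with hv
  have h1 : A *ᵥ u = y := by rw [hu, mulVec_mulVec, mul_nonsing_inv _ uA, one_mulVec]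
  have h2 : B *ᵥ v = y := by rw [hv, mulVec_mulVec, mul_nonsing_inv _ uB, one_mulVec]
  have hu0 : u ≠ 0 := by
    intro h
    rw [h, mulVec_zero] at h1
    exact hy h1.symm
  have e1 := hB.posSemidef.dotProduct_mulVec_nonneg (u - v)
  have e2 := hAB.dotProduct_mulVec_pos hu0
  have hs : v ⬝ᵥ (B *ᵥ u) = u ⬝ᵥ y := by
    have hT : Bᵀ = B := by simpa using hB.isHermitian.eq
    rw [dotProduct_mulVec, ← mulVec_transpose, hT, h2, dotProduct_comm]
  simp only [star_trivial, sub_mulVec, mulVec_sub, sub_dotProduct, dotProduct_sub, h1, h2, hs] at e1 e2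
  rw [dotProduct_comm y u, dotProduct_comm y v]
  linarith

theorem aux_fact {p : ℕ} (Ωg : Matrix (Fin p) (Fin p) ℝ) (hΩg : Ωg.PosSemidef)
    (ψ : Fin p → ℝ) (hψ : ∀ i, 0 < ψ i) (μ : Fin p → ℝ) (hμ : ∀ i, 0 < μ i) :
    (Ωg + diagonal (fun i => ψ i / μ i)).PosDef ∧
    IsUnit (diagonal μ * Ωg + diagonal ψ).det ∧
    (diagonal μ * Ωg + diagonal ψ)⁻¹ * diagonal μ =
      (Ωg + diagonal (fun i => ψ i / μ i))⁻¹ := by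
  have hP : (Ωg + diagonal (fun i => ψ i / μ i)).PosDef :=
    PosDef.posSemidef_add hΩg (PosDef.diagonal fun i => div_pos (hψ i) (hμ i))
  have hE : diagonal μ * Ωg + diagonal ψ =
      diagonal μ * (Ωg + diagonal (fun i => ψ i / μ i)) := by
    rw [mul_add, diagonal_mul_diagonal]
    congr 2
    funext i
    have := (hμ i).ne'
    field_simp
  have hd : IsUnit (diagonal μ).det := (PosDef.diagonal hμ).det_pos.ne'.isUnit
  refine ⟨hP, ?_, ?_⟩
  · rw [hE, det_mul]
    exact hd.mul hP.det_pos.ne'.isUnit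
  · rw [hE, Matrix.mul_inv_rev, Matrix.mul_assoc, nonsing_inv_mul _ hd, Matrix.mul_one]

/-- the TCP-like optimal cost `c − xᵀFᵀ(Ῡ Ωg + Ψ)⁻¹ Ῡ F x` is strictly
decreasing in the packet-transmission probabilities: if `0 < μ₁ i < μ₂ i` for every `i`
and `F x ≠ 0`, then both `Ῡ₁ Ωg + Ψ` and `Ῡ₂ Ωg + Ψ` are invertible and the quadratic
form at `Ῡ₂` strictly exceeds the one at `Ῡ₁`. -/
theorem tcp_cost_strictly_decreasing
    (p n : ℕ) (hp : 0 < p) (hn : 0 < n)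
    (Ωg : Matrix (Fin p) (Fin p) ℝ) (hΩg : Ωg.PosSemidef)
    (ψ : Fin p → ℝ) (hψ : ∀ i, 0 < ψ i)
    (μ₁ μ₂ : Fin p → ℝ) (hμ : ∀ i, 0 < μ₁ i ∧ μ₁ i < μ₂ i)
    (F : Matrix (Fin p) (Fin n) ℝ) (x : Fin n → ℝ)
    (hFx : F *ᵥ x ≠ 0) :
    let Ψ : Matrix (Fin p) (Fin p) ℝ := Matrix.diagonal ψ
    let Υ₁ : Matrix (Fin p) (Fin p) ℝ := Matrix.diagonal μ₁
    let Υ₂ : Matrix (Fin p) (Fin p) ℝ := Matrix.diagonal μ₂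
    IsUnit (Υ₁ * Ωg + Ψ).det ∧ IsUnit (Υ₂ * Ωg + Ψ).det ∧
      (F *ᵥ x) ⬝ᵥ (((Υ₂ * Ωg + Ψ)⁻¹ * Υ₂) *ᵥ (F *ᵥ x)) >
        (F *ᵥ x) ⬝ᵥ (((Υ₁ * Ωg + Ψ)⁻¹ * Υ₁) *ᵥ (F *ᵥ x)) ∧
      ∀ c : ℝ,
        c - (F *ᵥ x) ⬝ᵥ (((Υ₂ * Ωg + Ψ)⁻¹ * Υ₂) *ᵥ (F *ᵥ x)) <
          c - (F *ᵥ x) ⬝ᵥ (((Υ₁ * Ωg + Ψ)⁻¹ * Υ₁) *ᵥ (F *ᵥ x)) := by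
  intro Ψ Υ₁ Υ₂
  obtain ⟨p1, d1, e1⟩ := aux_fact Ωg hΩg ψ hψ μ₁ (fun i => (hμ i).1)
  obtain ⟨p2, d2, e2⟩ := aux_fact Ωg hΩg ψ hψ μ₂ (fun i => (hμ i).1.trans (hμ i).2)
  have key : (F *ᵥ x) ⬝ᵥ (((Υ₂ * Ωg + Ψ)⁻¹ * Υ₂) *ᵥ (F *ᵥ x)) >
        (F *ᵥ x) ⬝ᵥ (((Υ₁ * Ωg + Ψ)⁻¹ * Υ₁) *ᵥ (F *ᵥ x)) := by
    simp only [Ψ, Υ₁, Υ₂]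
    rw [e1, e2]
    refine aux_inv _ _ p1 p2 ?_ _ hFx
    rw [add_sub_add_left_eq_sub, diagonal_sub]
    refine PosDef.diagonal fun i => sub_pos.2 ?_
    exact div_lt_div_of_pos_left (hψ i) (hμ i).1 (hμ i).2
  exact ⟨d1, d2, key, fun c => sub_lt_sub_left key c⟩
end

section
/- Assume μ_i > 0 for every i. Then Ῡ G_F = Ῡ Ω_g Ῡ + Ῡ Ψ is symmetric positive definite, G_F is invertible, and the quadratic function J : ℝ^p → ℝ given by J(U) = U^T Ῡ (2 F x + G_F U) attains its unique global minimum at U* = −G_F^{-1} F x, with minimum value J(U*) = −x^T F^T Ῡ G_F^{-1} F x. (This is the TCP-like optimal control law and optimal cost.) -/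
open Matrix

/-- TCP-like optimal control law and optimal cost: if `μ i > 0` for every `i`,
then `Ῡ G_F = Ῡ Ωg Ῡ + Ῡ Ψ` is symmetric positive definite, `G_F = Ωg Ῡ + Ψ` is invertible,
and the quadratic cost `J(U) = Uᵀ Ῡ (2 F x + G_F U)` attains its unique global minimum at
`U* = −G_F⁻¹ F x`, with minimum value `J(U*) = −xᵀFᵀ Ῡ G_F⁻¹ F x`. -/
theorem tcp_optimal_control_law
    (p n : ℕ) (hp : 0 < p) (hn : 0 < n)
    (Ωg : Matrix (Fin p) (Fin p) ℝ) (hΩg : Ωg.PosSemidef)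
    (ψ : Fin p → ℝ) (hψ : ∀ i, 0 < ψ i)
    (μ : Fin p → ℝ) (hμ : ∀ i, 0 < μ i)
    (F : Matrix (Fin p) (Fin n) ℝ) (x : Fin n → ℝ) :
    let Ψ : Matrix (Fin p) (Fin p) ℝ := Matrix.diagonal ψ
    let Υ : Matrix (Fin p) (Fin p) ℝ := Matrix.diagonal μ
    let GF : Matrix (Fin p) (Fin p) ℝ := Ωg * Υ + Ψ
    let J : (Fin p → ℝ) → ℝ :=
      fun U => U ⬝ᵥ (Υ *ᵥ ((2 : ℝ) • (F *ᵥ x) + GF *ᵥ U))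
    let Ustar : Fin p → ℝ := -(GF⁻¹ *ᵥ (F *ᵥ x))
    (Υ * GF).PosDef ∧
    Υ * GF = Υ * Ωg * Υ + Υ * Ψ ∧
    IsUnit GF.det ∧
    (∀ U : Fin p → ℝ, J Ustar ≤ J U) ∧
    (∀ U : Fin p → ℝ, J U = J Ustar → U = Ustar) ∧
    J Ustar = -((F *ᵥ x) ⬝ᵥ ((Υ * GF⁻¹) *ᵥ (F *ᵥ x))) := by
  intro Ψ Υ GF J Ustar
  have hA : Υ * GF = Υ * Ωg * Υ + Υ * Ψ := by
    simp only [GF, Matrix.mul_add, Matrix.mul_assoc]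
  have hPD : (Υ * GF).PosDef := by
    rw [hA]
    have h1 : (Υ * Ωg * Υ).PosSemidef := by
      have h := hΩg.mul_mul_conjTranspose_same Υ
      have e : Υᴴ = Υ := by simp [Υ, Matrix.diagonal_conjTranspose]
      rwa [e] at h
    have h2 : (Υ * Ψ).PosDef := by
      simp only [Υ, Ψ, Matrix.diagonal_mul_diagonal]
      exact Matrix.PosDef.diagonal (fun i => mul_pos (hμ i) (hψ i))
    exact Matrix.PosDef.posSemidef_add h1 h2
  have hdet : IsUnit GF.det := by
    have h := hPD.det_pos
    rw [Matrix.det_mul] at h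
    exact isUnit_iff_ne_zero.mpr (right_ne_zero_of_mul h.ne')
  have hb : F *ᵥ x = -(GF *ᵥ Ustar) := by
    simp [Ustar, Matrix.mulVec_neg, Matrix.mulVec_mulVec, ← Matrix.mul_assoc, Matrix.mul_nonsing_inv _ hdet]
  have hsymm : ∀ u v : Fin p → ℝ, u ⬝ᵥ ((Υ * GF) *ᵥ v) = v ⬝ᵥ ((Υ * GF) *ᵥ u) := by
    intro u v
    have e : (Υ * GF)ᵀ = Υ * GF := by
      have := hPD.isHermitian.eq
      rwa [Matrix.conjTranspose_eq_transpose_of_trivial] at this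
    rw [Matrix.dotProduct_mulVec, ← Matrix.mulVec_transpose, e, dotProduct_comm]
  have hJ0 : ∀ U, J U = U ⬝ᵥ ((Υ * GF) *ᵥ U) - 2 * (U ⬝ᵥ ((Υ * GF) *ᵥ Ustar)) := by
    intro U
    simp only [J]
    rw [hb]
    simp only [Matrix.mulVec_add, Matrix.mulVec_smul, Matrix.mulVec_neg, Matrix.mulVec_mulVec,
      dotProduct_add, dotProduct_smul, dotProduct_neg, smul_eq_mul]
    ring
  have hJ : ∀ U, J U = J Ustar + (U - Ustar) ⬝ᵥ ((Υ * GF) *ᵥ (U - Ustar)) := by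
    intro U
    rw [hJ0 U, hJ0 Ustar]
    simp only [Matrix.mulVec_sub, dotProduct_sub, sub_dotProduct]
    rw [hsymm Ustar U]
    ring
  refine ⟨hPD, hA, hdet, ?_, ?_, ?_⟩
  · intro U
    have h := hPD.posSemidef.dotProduct_mulVec_nonneg (U - Ustar)
    simp only [star_trivial] at h
    rw [hJ U]
    linarith
  · intro U hU
    by_contra hne
    have h := hPD.dotProduct_mulVec_pos (sub_ne_zero.mpr hne)
    simp only [star_trivial] at h
    have := hJ U
    linarith
  · have h1 : J Ustar = Ustar ⬝ᵥ (Υ *ᵥ (F *ᵥ x)) := by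
      rw [hJ0, hb]
      simp only [Matrix.mulVec_neg, Matrix.mulVec_mulVec, dotProduct_neg]
      ring
    have e : Υᵀ = Υ := by simp [Υ]
    rw [h1, Matrix.dotProduct_mulVec, ← Matrix.mulVec_transpose, e, dotProduct_comm]
    simp only [Ustar, Matrix.mulVec_neg, Matrix.mulVec_mulVec, dotProduct_neg, Matrix.mul_assoc]
end

section
/- Assume 0 < μ_i ≤ 1 for every i. Then Ῡ G_G = Ῡ Ω_g Ῡ + Ῡ Ψ + Ῡ Ω_d (I − Ῡ) is symmetric positive definite, G_G is invertible, and the quadratic function J : ℝ^p → ℝ given by J(U) = U^T Ῡ (2 F x + G_G U) attains its unique global minimum at U* = −G_G^{-1} F x, with minimum value J(U*) = −x^T F^T Ῡ G_G^{-1} F x. (This is the UDP-like optimal control law and optimal cost.) -/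
open Matrix

/-- UDP-like optimal control law and optimal cost: if `0 < μ i ≤ 1` for every `i`,
then `Ῡ G_G = Ῡ Ωg Ῡ + Ῡ Ψ + Ῡ Ωd (I − Ῡ)` is symmetric positive definite,
`G_G = Ωg Ῡ + Ψ + Ωd (I − Ῡ)` is invertible, and the quadratic cost
`J(U) = Uᵀ Ῡ (2 F x + G_G U)` attains its unique global minimum at `U* = −G_G⁻¹ F x`,
with minimum value `J(U*) = −xᵀFᵀ Ῡ G_G⁻¹ F x`. -/
theorem udp_optimal_control_law
    (p n : ℕ) (hp : 0 < p) (hn : 0 < n)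
    (Ωg : Matrix (Fin p) (Fin p) ℝ) (hΩg : Ωg.PosSemidef)
    (ψ : Fin p → ℝ) (hψ : ∀ i, 0 < ψ i)
    (μ : Fin p → ℝ) (hμ : ∀ i, 0 < μ i ∧ μ i ≤ 1)
    (F : Matrix (Fin p) (Fin n) ℝ) (x : Fin n → ℝ) :
    let Ψ : Matrix (Fin p) (Fin p) ℝ := Matrix.diagonal ψ
    let Ωd : Matrix (Fin p) (Fin p) ℝ := Matrix.diagonal (fun i => Ωg i i)
    let Υ : Matrix (Fin p) (Fin p) ℝ := Matrix.diagonal μ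
    let GG : Matrix (Fin p) (Fin p) ℝ := Ωg * Υ + Ψ + Ωd * (1 - Υ)
    let J : (Fin p → ℝ) → ℝ :=
      fun U => U ⬝ᵥ (Υ *ᵥ ((2 : ℝ) • (F *ᵥ x) + GG *ᵥ U))
    let Ustar : Fin p → ℝ := -(GG⁻¹ *ᵥ (F *ᵥ x))
    (Υ * GG).PosDef ∧
    Υ * GG = Υ * Ωg * Υ + Υ * Ψ + Υ * Ωd * (1 - Υ) ∧
    IsUnit GG.det ∧
    (∀ U : Fin p → ℝ, J Ustar ≤ J U) ∧
    (∀ U : Fin p → ℝ, J U = J Ustar → U = Ustar) ∧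
    J Ustar = -((F *ᵥ x) ⬝ᵥ ((Υ * GG⁻¹) *ᵥ (F *ᵥ x))) := by
  intro Ψ Ωd Υ GG J Ustar
  have hexp : Υ * GG = Υ * Ωg * Υ + Υ * Ψ + Υ * Ωd * (1 - Υ) := by
    simp only [GG, mul_add, Matrix.mul_assoc]
  have hΥt : Υᵀ = Υ := Matrix.diagonal_transpose μ
  have hPD : (Υ * GG).PosDef := by
    rw [hexp]
    have h1 : (Υ * Ωg * Υ).PosSemidef := by
      have h := hΩg.conjTranspose_mul_mul_same Υ
      rwa [Matrix.conjTranspose_eq_transpose_of_trivial, hΥt] at h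
    have h2 : (Υ * Ψ).PosDef := by
      simp only [Υ, Ψ, Matrix.diagonal_mul_diagonal]
      exact Matrix.PosDef.diagonal (fun i => mul_pos (hμ i).1 (hψ i))
    have h3 : (Υ * Ωd * (1 - Υ)).PosSemidef := by
      have h1d : (1 - Υ) = Matrix.diagonal (fun i => 1 - μ i) := by
        rw [← Matrix.diagonal_one, Matrix.diagonal_sub]
      rw [h1d]
      simp only [Υ, Ωd, Matrix.diagonal_mul_diagonal]
      refine Matrix.PosSemidef.diagonal (fun i => ?_)
      exact mul_nonneg (mul_nonneg (hμ i).1.le hΩg.diag_nonneg) (sub_nonneg.2 (hμ i).2)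
    exact (Matrix.PosDef.posSemidef_add h1 h2).add_posSemidef h3
  have hdet : IsUnit GG.det := by
    have h := (Matrix.isUnit_iff_isUnit_det _).1 hPD.isUnit
    rw [Matrix.det_mul] at h
    exact isUnit_of_mul_isUnit_right h
  have hGV : GG *ᵥ Ustar = -(F *ᵥ x) := by
    simp only [Ustar, Matrix.mulVec_neg, Matrix.mulVec_mulVec, Matrix.mul_nonsing_inv_cancel_left _ _ hdet]
  have hb : F *ᵥ x = -(GG *ᵥ Ustar) := by rw [hGV, neg_neg]
  have hAt : (Υ * GG)ᵀ = Υ * GG := by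
    rw [← Matrix.conjTranspose_eq_transpose_of_trivial]; exact hPD.isHermitian
  have hJ : ∀ U, J U = U ⬝ᵥ ((Υ * GG) *ᵥ U) - 2 * (U ⬝ᵥ ((Υ * GG) *ᵥ Ustar)) := by
    intro U
    simp only [J]
    rw [hb]
    simp only [Matrix.mulVec_add, Matrix.mulVec_smul, Matrix.mulVec_neg, Matrix.mulVec_mulVec,
      dotProduct_add, dotProduct_smul, dotProduct_neg, smul_eq_mul]
    ring
  have hsymm : ∀ U V : Fin p → ℝ, U ⬝ᵥ ((Υ * GG) *ᵥ V) = V ⬝ᵥ ((Υ * GG) *ᵥ U) := by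
    intro U V
    rw [Matrix.dotProduct_mulVec, ← Matrix.mulVec_transpose, hAt, dotProduct_comm]
  have hdiff : ∀ U, J U - J Ustar = (U - Ustar) ⬝ᵥ ((Υ * GG) *ᵥ (U - Ustar)) := by
    intro U
    rw [hJ, hJ]
    simp only [Matrix.mulVec_sub, dotProduct_sub, sub_dotProduct]
    rw [hsymm Ustar U]
    ring
  refine ⟨hPD, hexp, hdet, ?_, ?_, ?_⟩
  · intro U
    have h := hPD.posSemidef.dotProduct_mulVec_nonneg (U - Ustar)
    rw [star_trivial, ← hdiff] at h
    linarith
  · intro U hU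
    by_contra hne
    have h := hPD.dotProduct_mulVec_pos (sub_ne_zero.2 hne)
    rw [star_trivial, ← hdiff] at h
    linarith
  · have h1 : J Ustar = Ustar ⬝ᵥ (Υ *ᵥ (F *ᵥ x)) := by
      simp only [J]
      rw [hGV, two_smul, add_neg_cancel_right]
    rw [h1, ← Matrix.mulVec_mulVec, Matrix.dotProduct_mulVec (F *ᵥ x), ← Matrix.mulVec_transpose,
      hΥt, dotProduct_comm (Υ *ᵥ (F *ᵥ x))]
    simp only [Ustar, neg_dotProduct]
end

section
/- Assume every diagonal entry of Ω_g is strictly positive and F x ≠ 0. For ν ∈ [0,1] the matrices G_F(ν) = ν Ω_g + Ψ and G_G(ν) = ν Ω_h + Ω_d + Ψ are invertible, and the cost-difference function J_Δ(ν) = ν (1 − ν) x^T F^T G_G(ν)^{-1} Ω_d G_F(ν)^{-1} F x is well defined on [0,1]. There exists ν* ∈ (0,1) such that J_Δ(ν*) > 0 and J_Δ(ν) ≤ J_Δ(ν*) for all ν ∈ [0,1]; in particular the maximal cost difference between the UDP-like and TCP-like protocols is attained at an interior point of [0,1]. -/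
open Matrix

theorem aux_pos {p : ℕ} (A B D : Matrix (Fin p) (Fin p) ℝ) (hA : A.PosDef) (hB : B.PosDef)
    (hD : D.PosDef) (c : ℝ) (hc : 0 < c) (h : B = A + c • D) (y : Fin p → ℝ) (hy : y ≠ 0) :
    0 < y ⬝ᵥ ((B⁻¹ * D * A⁻¹) *ᵥ y) := by
  have hAu : IsUnit A.det := hA.det_pos.ne'.isUnit
  have hBu : IsUnit B.det := hB.det_pos.ne'.isUnit
  have hBs : Bᵀ = B := by simpa using hB.isHermitian.eq
  obtain ⟨u, hu⟩ : ∃ u, u = A⁻¹ *ᵥ y := ⟨_, rfl⟩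
  obtain ⟨v, hv⟩ : ∃ v, v = B⁻¹ *ᵥ y := ⟨_, rfl⟩
  have hAu' : A *ᵥ u = y := by
    rw [hu, mulVec_mulVec, mul_nonsing_inv _ hAu, one_mulVec]
  have hBv : B *ᵥ v = y := by
    rw [hv, mulVec_mulVec, mul_nonsing_inv _ hBu, one_mulVec]
  have hv0 : v ≠ 0 := by
    rintro rfl
    exact hy (by rw [← hBv, mulVec_zero])
  have hval : y ⬝ᵥ ((B⁻¹ * D * A⁻¹) *ᵥ y) = v ⬝ᵥ (D *ᵥ u) := by
    rw [← mulVec_mulVec, ← mulVec_mulVec, ← hu, dotProduct_mulVec, hv,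
      ← mulVec_transpose, transpose_nonsing_inv, hBs]
  have hDs : Dᵀ = D := by simpa using hD.isHermitian.eq
  have hw : A *ᵥ (u - v) = c • (D *ᵥ v) := by
    rw [mulVec_sub, hAu', ← hBv, h, add_mulVec, smul_mulVec, add_sub_cancel_left]
  have h1 : 0 < v ⬝ᵥ (D *ᵥ v) := by simpa using hD.dotProduct_mulVec_pos hv0
  have h2 : 0 ≤ (u - v) ⬝ᵥ (A *ᵥ (u - v)) := by
    simpa using hA.posSemidef.dotProduct_mulVec_nonneg (u - v)
  rw [hw, dotProduct_smul, smul_eq_mul] at h2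
  have h3 := nonneg_of_mul_nonneg_right h2 hc
  have h4 : u ⬝ᵥ (D *ᵥ v) = v ⬝ᵥ (D *ᵥ u) := by
    rw [dotProduct_mulVec, ← mulVec_transpose, hDs, dotProduct_comm]
  rw [sub_dotProduct, h4] at h3
  rw [hval]
  linarith

theorem aux_cont {p : ℕ} (A : ℝ → Matrix (Fin p) (Fin p) ℝ) (hA : Continuous A) (s : Set ℝ)
    (h : ∀ t ∈ s, IsUnit (A t).det) : ContinuousOn (fun t => (A t)⁻¹) s := by
  simp only [Matrix.inv_def, Ring.inverse_eq_inv']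
  exact ContinuousOn.smul
    (hA.matrix_det.continuousOn.inv₀ (fun t ht => (h t ht).ne_zero))
    hA.matrix_adjugate.continuousOn

/-- scalar channel, maximal cost difference: if every diagonal entry of `Ωg`
is strictly positive and `F x ≠ 0`, then for every `ν ∈ [0,1]` the matrices
`G_F(ν) = ν Ωg + Ψ` and `G_G(ν) = ν Ωh + Ωd + Ψ` are invertible, and the cost-difference
function `J_Δ(ν) = ν (1 − ν) xᵀFᵀ G_G(ν)⁻¹ Ωd G_F(ν)⁻¹ F x` attains a strictly positive
maximum over `[0,1]` at some interior point `ν* ∈ (0,1)`. -/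
theorem cost_difference_max_interior
    (p n : ℕ) (hp : 0 < p) (hn : 0 < n)
    (Ωg : Matrix (Fin p) (Fin p) ℝ) (hΩg : Ωg.PosSemidef)
    (hΩgd : ∀ i, 0 < Ωg i i)
    (ψ : Fin p → ℝ) (hψ : ∀ i, 0 < ψ i)
    (F : Matrix (Fin p) (Fin n) ℝ) (x : Fin n → ℝ)
    (hFx : F *ᵥ x ≠ 0) :
    let Ψ : Matrix (Fin p) (Fin p) ℝ := Matrix.diagonal ψ
    let Ωd : Matrix (Fin p) (Fin p) ℝ := Matrix.diagonal (fun i => Ωg i i)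
    let Ωh : Matrix (Fin p) (Fin p) ℝ := Ωg - Ωd
    let GF : ℝ → Matrix (Fin p) (Fin p) ℝ := fun ν => ν • Ωg + Ψ
    let GG : ℝ → Matrix (Fin p) (Fin p) ℝ := fun ν => ν • Ωh + Ωd + Ψ
    let JΔ : ℝ → ℝ := fun ν =>
      ν * (1 - ν) * ((F *ᵥ x) ⬝ᵥ (((GG ν)⁻¹ * Ωd * (GF ν)⁻¹) *ᵥ (F *ᵥ x)))
    (∀ ν ∈ Set.Icc (0 : ℝ) 1, IsUnit (GF ν).det ∧ IsUnit (GG ν).det) ∧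
    ∃ νstar ∈ Set.Ioo (0 : ℝ) 1,
      0 < JΔ νstar ∧ ∀ ν ∈ Set.Icc (0 : ℝ) 1, JΔ ν ≤ JΔ νstar := by
  intro Ψ Ωd Ωh GF GG JΔ
  have hΨ : Ψ.PosDef := PosDef.diagonal hψ
  have hD : Ωd.PosDef := PosDef.diagonal hΩgd
  have hGF : ∀ ν ∈ Set.Icc (0 : ℝ) 1, (GF ν).PosDef := fun ν hν =>
    PosDef.posSemidef_add (hΩg.smul hν.1) hΨ
  have hrel : ∀ ν, GG ν = GF ν + (1 - ν) • Ωd := by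
    intro ν
    simp only [GG, GF, Ωh, smul_sub, sub_smul, one_smul]
    abel
  have hGG : ∀ ν ∈ Set.Icc (0 : ℝ) 1, (GG ν).PosDef := by
    intro ν hν
    rw [hrel]
    exact (hGF ν hν).add_posSemidef (hD.posSemidef.smul (sub_nonneg.2 hν.2))
  have hu : ∀ ν ∈ Set.Icc (0 : ℝ) 1, IsUnit (GF ν).det ∧ IsUnit (GG ν).det := fun ν hν =>
    ⟨(hGF ν hν).det_pos.ne'.isUnit, (hGG ν hν).det_pos.ne'.isUnit⟩
  refine ⟨hu, ?_⟩
  have cF : ContinuousOn (fun t => (GF t)⁻¹) (Set.Icc 0 1) :=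
    aux_cont GF (by fun_prop) _ fun t ht => (hu t ht).1
  have cG : ContinuousOn (fun t => (GG t)⁻¹) (Set.Icc 0 1) :=
    aux_cont GG (by fun_prop) _ fun t ht => (hu t ht).2
  have cM : ContinuousOn (fun t => (GG t)⁻¹ * Ωd * (GF t)⁻¹) (Set.Icc 0 1) :=
    (cG.mul continuousOn_const).mul cF
  have hq : Continuous (fun M : Matrix (Fin p) (Fin p) ℝ => (F *ᵥ x) ⬝ᵥ (M *ᵥ (F *ᵥ x))) :=
    Continuous.dotProduct continuous_const (Continuous.matrix_mulVec continuous_id continuous_const)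
  have cJ : ContinuousOn JΔ (Set.Icc 0 1) :=
    ContinuousOn.mul (by fun_prop) (hq.comp_continuousOn cM)
  obtain ⟨m, hm, hmax⟩ := isCompact_Icc.exists_isMaxOn ⟨(0 : ℝ), by simp⟩ cJ
  have hh : (1 / 2 : ℝ) ∈ Set.Icc (0 : ℝ) 1 := by constructor <;> norm_num
  have hhalf : 0 < JΔ (1 / 2) :=
    mul_pos (by norm_num) (aux_pos _ _ _ (hGF _ hh) (hGG _ hh) hD (1 - 1 / 2) (by norm_num)
      (hrel _) _ hFx)
  have hpos : 0 < JΔ m := lt_of_lt_of_le hhalf (hmax hh)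
  refine ⟨m, ⟨lt_of_le_of_ne hm.1 ?_, lt_of_le_of_ne hm.2 ?_⟩, hpos, fun ν hν => hmax hν⟩
  · rintro rfl
    simp [JΔ] at hpos
  · rintro rfl
    simp [JΔ] at hpos
end

section
/- Assume every diagonal entry of Ω_g is strictly positive and F x ≠ 0. For every ν₁ ∈ (0,1) there exists ν₂ ∈ (0, ν₁) such that ν₂ · x^T F^T (ν₂ Ω_g + Ψ)^{-1} F x = ν₁ · x^T F^T (ν₁ Ω_h + Ω_d + Ψ)^{-1} F x; that is, the TCP-like protocol achieves the UDP-like optimal cost c − ν₁ x^T F^T G_G(ν₁)^{-1} F x with a strictly smaller packet-transmission probability ν₂ < ν₁. -/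
open Matrix

theorem aux_lt {p : ℕ} (A D : Matrix (Fin p) (Fin p) ℝ) (hA : A.PosDef) (hD : D.PosDef)
    (y : Fin p → ℝ) (hy : y ≠ 0) :
    0 < y ⬝ᵥ ((A + D)⁻¹ *ᵥ y) ∧ y ⬝ᵥ ((A + D)⁻¹ *ᵥ y) < y ⬝ᵥ (A⁻¹ *ᵥ y) := by
  have hB : (A + D).PosDef := hA.add hD
  have hAu : A *ᵥ (A⁻¹ *ᵥ y) = y := by
    rw [mulVec_mulVec, mul_nonsing_inv _ ((isUnit_iff_isUnit_det _).1 hA.isUnit), one_mulVec]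
  have hBw : (A + D) *ᵥ ((A + D)⁻¹ *ᵥ y) = y := by
    rw [mulVec_mulVec, mul_nonsing_inv _ ((isUnit_iff_isUnit_det _).1 hB.isUnit), one_mulVec]
  generalize (A + D)⁻¹ *ᵥ y = w at *
  generalize A⁻¹ *ᵥ y = u at *
  have hw : w ≠ 0 := by
    rintro rfl
    exact hy (by rw [← hBw, mulVec_zero])
  have h1 := hB.dotProduct_mulVec_pos hw
  have h2 := hD.dotProduct_mulVec_pos hw
  have h3 := hA.posSemidef.dotProduct_mulVec_nonneg (u - w)
  have hsym : u ⬝ᵥ (A *ᵥ w) = w ⬝ᵥ (A *ᵥ u) := by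
    have hT : Aᵀ = A := by simpa using hA.isHermitian.eq
    rw [dotProduct_mulVec, ← mulVec_transpose, hT, dotProduct_comm]
  have h4 : w ⬝ᵥ (A *ᵥ w) + w ⬝ᵥ (D *ᵥ w) = w ⬝ᵥ y := by
    rw [← dotProduct_add, ← add_mulVec, hBw]
  simp only [star_trivial] at h1 h2 h3
  rw [hBw] at h1
  rw [mulVec_sub, dotProduct_sub, sub_dotProduct, sub_dotProduct, hsym, hAu] at h3
  rw [dotProduct_comm y w, dotProduct_comm y u]
  exact ⟨h1, by linarith⟩

/-- scalar channel: for every `ν₁ ∈ (0,1)` there is a strictly smaller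
`ν₂ ∈ (0, ν₁)` at which the TCP-like protocol achieves the UDP-like optimal cost, i.e.
`ν₂ · xᵀFᵀ(ν₂ Ωg + Ψ)⁻¹ F x = ν₁ · xᵀFᵀ(ν₁ Ωh + Ωd + Ψ)⁻¹ F x`. -/
theorem tcp_matches_udp_cost_with_smaller_probability
    (p n : ℕ) (hp : 0 < p) (hn : 0 < n)
    (Ωg : Matrix (Fin p) (Fin p) ℝ) (hΩg : Ωg.PosSemidef)
    (hΩgd : ∀ i, 0 < Ωg i i)
    (ψ : Fin p → ℝ) (hψ : ∀ i, 0 < ψ i)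
    (F : Matrix (Fin p) (Fin n) ℝ) (x : Fin n → ℝ)
    (hFx : F *ᵥ x ≠ 0) :
    let Ψ : Matrix (Fin p) (Fin p) ℝ := Matrix.diagonal ψ
    let Ωd : Matrix (Fin p) (Fin p) ℝ := Matrix.diagonal (fun i => Ωg i i)
    let Ωh : Matrix (Fin p) (Fin p) ℝ := Ωg - Ωd
    ∀ ν₁ ∈ Set.Ioo (0 : ℝ) 1, ∃ ν₂ ∈ Set.Ioo (0 : ℝ) ν₁,
      ν₂ * ((F *ᵥ x) ⬝ᵥ ((ν₂ • Ωg + Ψ)⁻¹ *ᵥ (F *ᵥ x))) =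
        ν₁ * ((F *ᵥ x) ⬝ᵥ ((ν₁ • Ωh + Ωd + Ψ)⁻¹ *ᵥ (F *ᵥ x))) := by
  intro Ψ Ωd Ωh ν₁ hν
  obtain ⟨h0, h1⟩ := hν
  have hΨ : Ψ.PosDef := PosDef.diagonal hψ
  have hΩd : Ωd.PosDef := PosDef.diagonal hΩgd
  have hA : ∀ ν : ℝ, 0 ≤ ν → (ν • Ωg + Ψ).PosDef := fun ν h =>
    PosDef.posSemidef_add (hΩg.smul h) hΨ
  have hD : ((1 - ν₁) • Ωd).PosDef := hΩd.smul (by linarith)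
  have hB : ν₁ • Ωh + Ωd + Ψ = (ν₁ • Ωg + Ψ) + (1 - ν₁) • Ωd := by
    simp only [Ωh, smul_sub, sub_smul, one_smul]
    abel
  obtain ⟨hp1, hp2⟩ := aux_lt _ _ (hA ν₁ h0.le) hD _ hFx
  rw [← hB] at hp1 hp2
  have hc : ContinuousOn (fun ν : ℝ => ν * ((F *ᵥ x) ⬝ᵥ ((ν • Ωg + Ψ)⁻¹ *ᵥ (F *ᵥ x))))
      (Set.Icc 0 ν₁) := by
    have hl : Continuous (fun ν : ℝ => ν • Ωg + Ψ) := by fun_prop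
    have hi : ContinuousOn (fun ν : ℝ => (ν • Ωg + Ψ)⁻¹) (Set.Icc 0 ν₁) := by
      simp only [inv_def, Ring.inverse_eq_inv']
      refine ContinuousOn.smul (ContinuousOn.inv₀ hl.matrix_det.continuousOn ?_)
        hl.matrix_adjugate.continuousOn
      intro ν h
      exact (hA ν h.1).det_pos.ne'
    refine continuousOn_id.mul ?_
    have hq : Continuous (fun M : Matrix (Fin p) (Fin p) ℝ => (F *ᵥ x) ⬝ᵥ (M *ᵥ (F *ᵥ x))) :=
      Continuous.dotProduct continuous_const (continuous_id.matrix_mulVec continuous_const)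
    exact hq.comp_continuousOn hi
  have := intermediate_value_Ioo h0.le hc
  obtain ⟨ν₂, h, he⟩ := this (show ν₁ * ((F *ᵥ x) ⬝ᵥ ((ν₁ • Ωh + Ωd + Ψ)⁻¹ *ᵥ (F *ᵥ x))) ∈ _ from
    ⟨by simpa only [zero_mul] using mul_pos h0 hp1, mul_lt_mul_of_pos_left hp2 h0⟩)
  exact ⟨ν₂, h, he⟩
end

section
/- Let ν ∈ ℝ be such that G_F(ν) = ν Ω_g + Ψ and G_G(ν) = ν Ω_h + Ω_d + Ψ are both invertible. Then G_F(ν)^{-1} − G_G(ν)^{-1} = (1 − ν) · G_G(ν)^{-1} Ω_d G_F(ν)^{-1}. Consequently, for every F and x, ν · x^T F^T ( G_F(ν)^{-1} − G_G(ν)^{-1} ) F x = ν (1 − ν) · x^T F^T G_G(ν)^{-1} Ω_d G_F(ν)^{-1} F x, i.e. the cost difference between the UDP-like and TCP-like protocols equals ν(1−ν) times a fixed quadratic expression. -/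
open Matrix

/-- algebraic identity for the scalar-channel cost difference: if
`G_F(ν) = ν Ωg + Ψ` and `G_G(ν) = ν Ωh + Ωd + Ψ` are both invertible, then
`G_F(ν)⁻¹ − G_G(ν)⁻¹ = (1 − ν) G_G(ν)⁻¹ Ωd G_F(ν)⁻¹`, and consequently for every `F`
and `x` the cost difference `ν xᵀFᵀ(G_F(ν)⁻¹ − G_G(ν)⁻¹) F x` equals
`ν (1 − ν) xᵀFᵀ G_G(ν)⁻¹ Ωd G_F(ν)⁻¹ F x`. -/
theorem cost_difference_factorization
    (p n : ℕ) (hp : 0 < p) (hn : 0 < n)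
    (Ωg Ψ : Matrix (Fin p) (Fin p) ℝ)
    (ν : ℝ)
    (hGF : IsUnit (ν • Ωg + Ψ).det)
    (hGG : IsUnit (ν • (Ωg - Matrix.diagonal (fun i => Ωg i i)) +
      Matrix.diagonal (fun i => Ωg i i) + Ψ).det) :
    let Ωd : Matrix (Fin p) (Fin p) ℝ := Matrix.diagonal (fun i => Ωg i i)
    let Ωh : Matrix (Fin p) (Fin p) ℝ := Ωg - Ωd
    let GF : Matrix (Fin p) (Fin p) ℝ := ν • Ωg + Ψ
    let GG : Matrix (Fin p) (Fin p) ℝ := ν • Ωh + Ωd + Ψ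
    GF⁻¹ - GG⁻¹ = (1 - ν) • (GG⁻¹ * Ωd * GF⁻¹) ∧
    ∀ (F : Matrix (Fin p) (Fin n) ℝ) (x : Fin n → ℝ),
      ν * ((F *ᵥ x) ⬝ᵥ ((GF⁻¹ - GG⁻¹) *ᵥ (F *ᵥ x))) =
        ν * (1 - ν) * ((F *ᵥ x) ⬝ᵥ ((GG⁻¹ * Ωd * GF⁻¹) *ᵥ (F *ᵥ x))) := by
  intro Ωd Ωh GF GG
  have hF : GF * GF⁻¹ = 1 := Matrix.mul_nonsing_inv GF hGF
  have hG : GG⁻¹ * GG = 1 := Matrix.nonsing_inv_mul GG hGG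
  have hd : GG - GF = (1 - ν) • Ωd := by
    simp only [GG, GF, Ωh, smul_sub, sub_smul, one_smul]
    abel
  have key : GF⁻¹ - GG⁻¹ = (1 - ν) • (GG⁻¹ * Ωd * GF⁻¹) := by
    calc GF⁻¹ - GG⁻¹ = GG⁻¹ * (GG - GF) * GF⁻¹ := by
          rw [Matrix.mul_sub, Matrix.sub_mul, hG, Matrix.mul_assoc GG⁻¹ GF, hF,
            Matrix.one_mul, Matrix.mul_one]
      _ = _ := by rw [hd, Matrix.mul_smul, Matrix.smul_mul]
  refine ⟨key, fun F x => ?_⟩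
  rw [key, Matrix.smul_mulVec, dotProduct_smul, smul_eq_mul, mul_assoc ν]
end

section
/- Let Ῡ₁, Ῡ₂ be invertible p×p matrices and Ω_g, Ψ be p×p matrices such that A₁ = Ῡ₁ Ω_g + Ψ and A₂ = Ῡ₂ Ω_g + Ψ are invertible. Then A₂^{-1} Ῡ₂ − A₁^{-1} Ῡ₁ = A₂^{-1} Ῡ₂ ( Ῡ₁^{-1} − Ῡ₂^{-1} ) Ψ A₁^{-1} Ῡ₁. -/
open Matrix

/-- algebraic factorization for comparing costs at two packet-transmission
matrices: if `Ῡ₁`, `Ῡ₂`, `A₁ = Ῡ₁ Ωg + Ψ`, and `A₂ = Ῡ₂ Ωg + Ψ` are all invertible, then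
`A₂⁻¹ Ῡ₂ − A₁⁻¹ Ῡ₁ = A₂⁻¹ Ῡ₂ (Ῡ₁⁻¹ − Ῡ₂⁻¹) Ψ A₁⁻¹ Ῡ₁`. -/
theorem inverse_weighted_difference_factorization
    (p : ℕ) (hp : 0 < p)
    (Υ₁ Υ₂ Ωg Ψ : Matrix (Fin p) (Fin p) ℝ)
    (hΥ₁ : IsUnit Υ₁.det) (hΥ₂ : IsUnit Υ₂.det)
    (hA₁ : IsUnit (Υ₁ * Ωg + Ψ).det) (hA₂ : IsUnit (Υ₂ * Ωg + Ψ).det) :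
    (Υ₂ * Ωg + Ψ)⁻¹ * Υ₂ - (Υ₁ * Ωg + Ψ)⁻¹ * Υ₁ =
      (Υ₂ * Ωg + Ψ)⁻¹ * Υ₂ * (Υ₁⁻¹ - Υ₂⁻¹) * Ψ * (Υ₁ * Ωg + Ψ)⁻¹ * Υ₁ := by
  have key : (Υ₁⁻¹ - Υ₂⁻¹) * Ψ = Υ₁⁻¹ * (Υ₁ * Ωg + Ψ) - Υ₂⁻¹ * (Υ₂ * Ωg + Ψ) := by
    rw [Matrix.mul_add, Matrix.mul_add, Matrix.nonsing_inv_mul_cancel_left _ _ hΥ₁,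
      Matrix.nonsing_inv_mul_cancel_left _ _ hΥ₂, Matrix.sub_mul]
    abel
  rw [Matrix.mul_assoc (_ * Υ₂) _ Ψ, key]
  generalize Υ₁ * Ωg + Ψ = A at *
  generalize Υ₂ * Ωg + Ψ = B at *
  have e1 : B⁻¹ * Υ₂ * (Υ₁⁻¹ * A) * A⁻¹ * Υ₁ = B⁻¹ * Υ₂ := by
    rw [← Matrix.mul_assoc, Matrix.mul_nonsing_inv_cancel_right _ _ hA₁,
      Matrix.nonsing_inv_mul_cancel_right _ _ hΥ₁]
  have e2 : B⁻¹ * Υ₂ * (Υ₂⁻¹ * B) * A⁻¹ * Υ₁ = A⁻¹ * Υ₁ := by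
    rw [← Matrix.mul_assoc, Matrix.mul_nonsing_inv_cancel_right _ _ hΥ₂,
      Matrix.nonsing_inv_mul _ hA₂, Matrix.one_mul]
  rw [Matrix.mul_sub, Matrix.sub_mul, Matrix.sub_mul, e1, e2]
end

section
/- Assume 0 < μ_i ≤ 1 for every i. Then G_G = Ω_g Ῡ + Ψ + Ω_d (I − Ῡ) is invertible and Ῡ G_G^{-1} = (Ω_g + Ψ Ῡ^{-1} + Ω_d (Ῡ^{-1} − I))^{-1}; in particular Ῡ G_G^{-1} is a symmetric positive definite matrix. -/
open Matrix

/-- if `0 < μ i ≤ 1` for every `i`, then `G_G = Ωg Ῡ + Ψ + Ωd (I − Ῡ)` is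
invertible, `Ῡ G_G⁻¹ = (Ωg + Ψ Ῡ⁻¹ + Ωd (Ῡ⁻¹ − I))⁻¹`, and `Ῡ G_G⁻¹` is symmetric
positive definite. -/
theorem udp_weighted_inverse_posdef
    (p n : ℕ) (hp : 0 < p) (hn : 0 < n)
    (Ωg : Matrix (Fin p) (Fin p) ℝ) (hΩg : Ωg.PosSemidef)
    (ψ : Fin p → ℝ) (hψ : ∀ i, 0 < ψ i)
    (μ : Fin p → ℝ) (hμ : ∀ i, 0 < μ i ∧ μ i ≤ 1) :
    let Ψ : Matrix (Fin p) (Fin p) ℝ := Matrix.diagonal ψ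
    let Ωd : Matrix (Fin p) (Fin p) ℝ := Matrix.diagonal (fun i => Ωg i i)
    let Υ : Matrix (Fin p) (Fin p) ℝ := Matrix.diagonal μ
    let GG : Matrix (Fin p) (Fin p) ℝ := Ωg * Υ + Ψ + Ωd * (1 - Υ)
    IsUnit GG.det ∧
    Υ * GG⁻¹ = (Ωg + Ψ * Υ⁻¹ + Ωd * (Υ⁻¹ - 1))⁻¹ ∧
    (Υ * GG⁻¹).PosDef := by
  intro Ψ Ωd Υ GG
  have hdet : IsUnit Υ.det := by
    rw [Matrix.det_diagonal, isUnit_iff_ne_zero]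
    exact Finset.prod_ne_zero_iff.mpr fun i _ => (hμ i).1.ne'
  have h1 : Υ⁻¹ * Υ = 1 := Matrix.nonsing_inv_mul _ hdet
  have h2 : Υ * Υ⁻¹ = 1 := Matrix.mul_nonsing_inv _ hdet
  have hinv : Υ⁻¹ = Matrix.diagonal (fun i => (μ i)⁻¹) := by
    apply Matrix.inv_eq_right_inv
    rw [Matrix.diagonal_mul_diagonal, ← Matrix.diagonal_one]
    congr 1
    funext i
    exact mul_inv_cancel₀ (hμ i).1.ne'
  set M := Ωg + Ψ * Υ⁻¹ + Ωd * (Υ⁻¹ - 1) with hM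
  have hG : GG = M * Υ := by
    simp only [GG, hM, add_mul, mul_assoc, sub_mul, h1, mul_one, one_mul]
  have hMpd : M.PosDef := by
    have e : M = Ωg + Matrix.diagonal
        (fun i => ψ i * (μ i)⁻¹ + Ωg i i * ((μ i)⁻¹ - 1)) := by
      rw [hM, hinv, ← Matrix.diagonal_one, Matrix.diagonal_sub,
        Matrix.diagonal_mul_diagonal, Matrix.diagonal_mul_diagonal, add_assoc,
        Matrix.diagonal_add]
    rw [e]
    refine Matrix.PosDef.posSemidef_add hΩg (Matrix.PosDef.diagonal fun i => ?_)
    have a : 0 < ψ i * (μ i)⁻¹ := mul_pos (hψ i) (inv_pos.mpr (hμ i).1)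
    have b : 0 ≤ (μ i)⁻¹ - 1 := sub_nonneg.mpr ((one_le_inv₀ (hμ i).1).mpr (hμ i).2)
    have c : 0 ≤ Ωg i i := hΩg.diag_nonneg
    exact add_pos_of_pos_of_nonneg a (mul_nonneg c b)
  have key : Υ * GG⁻¹ = M⁻¹ := by
    rw [hG, Matrix.mul_inv_rev, ← mul_assoc, h2, one_mul]
  refine ⟨?_, key, ?_⟩
  · rw [hG, Matrix.det_mul]
    exact (isUnit_iff_ne_zero.mpr hMpd.det_pos.ne').mul hdet
  · rw [key]
    exact hMpd.inv
end
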